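/- Let K be a field, d ≥ 2, and U, V finite-dimensional K-vector spaces. For q ∈ S^d(U ⊕ V), write q = q_0 + q_1 + ⋯ + q_d according to the decomposition S^d(U ⊕ V) = ⊕_{i=0}^d S^{d−i}U ⊗ S^iV, so that q_d ∈ S^d V. Then S(q) ≤ dim U + S(q_d). -/

import Mathlib

open MvPolynomial

noncomputable section

/-- `q ∈ S^d V` (for `V` the vector space with basis `σ`) admits a strength decomposition
with exactly `k` terms: `q = r 0 * s 0 + ⋯ + r (k-1) * s (k-1)` with `r i` homogeneous of
degree `e i ∈ {1, …, d-1}` and `s i` homogeneous of degree `d - e i`. -/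
def HasStrengthDecomp (K : Type) [Field K] (d : ℕ) {σ : Type}
    (q : MvPolynomial σ K) (k : ℕ) : Prop :=
  ∃ (e : Fin k → ℕ) (r s : Fin k → MvPolynomial σ K),
    (∀ i, 1 ≤ e i) ∧ (∀ i, e i ≤ d - 1) ∧
    (∀ i, (r i).IsHomogeneous (e i)) ∧
    (∀ i, (s i).IsHomogeneous (d - e i)) ∧
    q = ∑ i, r i * s i

/-- The strength `S(q)` of `q ∈ S^d V`: the minimal number of terms in a strength
decomposition of `q` (with the convention `S(0) = 0`). -/
def strength (K : Type) [Field K] (d : ℕ) {σ : Type} (q : MvPolynomial σ K) : ℕ :=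
  sInf {k | HasStrengthDecomp K d q k}

/-- The projection `S^d(U ⊕ V) → S^d V` sending `q = q_0 + ⋯ + q_d` (with
`q_i ∈ S^{d-i} U ⊗ S^i V`) to its last component `q_d ∈ S^d V`; concretely, it sets all the
`U`-variables to `0`.  Here `U = K^u` and `V = K^n`, and `S^d(U ⊕ V)` is the space of
homogeneous polynomials of degree `d` in the variables `Fin u ⊕ Fin n`. -/
def lastComponent (K : Type) [Field K] {u n : ℕ} (q : MvPolynomial (Fin u ⊕ Fin n) K) :
    MvPolynomial (Fin n) K :=
  aeval (Sum.elim (fun _ => (0 : MvPolynomial (Fin n) K)) X) q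

namespace MvPolynomial

theorem homogeneousComponent_X_mul {R σ : Type*} [CommSemiring R] (n : ℕ) (i : σ)
    (p : MvPolynomial σ R) :
    homogeneousComponent (n + 1) (X i * p) = X i * homogeneousComponent n p := by
  classical
  ext m
  simp only [coeff_homogeneousComponent, coeff_X_mul']
  by_cases hi : i ∈ m.support
  · obtain ⟨m', rfl⟩ : ∃ m', m = Finsupp.single i 1 + m' :=
      le_iff_exists_add.mp (Finsupp.single_le_iff.mpr
        (Nat.one_le_iff_ne_zero.mpr (Finsupp.mem_support_iff.mp hi)))
    simp [add_comm 1]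
  · simp [hi]

/-- A form of degree `n + 1` in an ideal generated by finitely many variables is a combination of
these variables with coefficients homogeneous of degree `n`. -/
theorem IsHomogeneous.exists_eq_sum_X_mul {R σ ι : Type*} [CommSemiring R] [Fintype ι]
    {n : ℕ} {p : MvPolynomial σ R} (hp : p.IsHomogeneous (n + 1)) {f : ι → σ}
    (hmem : p ∈ Ideal.span (Set.range fun i => (X (f i) : MvPolynomial σ R))) :
    ∃ s : ι → MvPolynomial σ R, (∀ i, (s i).IsHomogeneous n) ∧ p = ∑ i, X (f i) * s i := by
  obtain ⟨c, rfl⟩ := Ideal.mem_span_range_iff_exists_fun.mp hmem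
  refine ⟨fun i => homogeneousComponent n (c i),
    fun i => homogeneousComponent_isHomogeneous n (c i), ?_⟩
  rw [← homogeneousComponent_eq_self hp, map_sum]
  simp_rw [mul_comm (c _), homogeneousComponent_X_mul]

end MvPolynomial

/-- A form of degree `d ≥ 2` in the ideal generated by `k` variables has a strength decomposition
with `k` terms. -/
theorem hasStrengthDecomp_of_mem_span_X {K : Type} [Field K] {d : ℕ} (hd : 2 ≤ d) {σ : Type}
    {k : ℕ} {p : MvPolynomial σ K} (hp : p.IsHomogeneous d) {f : Fin k → σ}
    (hmem : p ∈ Ideal.span (Set.range fun i => (X (f i) : MvPolynomial σ K))) :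
    HasStrengthDecomp K d p k := by
  obtain ⟨n, rfl⟩ : ∃ n, d = n + 1 := ⟨d - 1, by omega⟩
  obtain ⟨s, hs, hsum⟩ := hp.exists_eq_sum_X_mul hmem
  exact ⟨fun _ => 1, fun i => X (f i), s, fun _ => le_rfl, fun _ => by dsimp only; omega,
    fun i => isHomogeneous_X K (f i), hs, hsum⟩

namespace HasStrengthDecomp

variable {K : Type} [Field K] {d : ℕ} {σ τ : Type}

theorem add {p q : MvPolynomial σ K} {k l : ℕ} (hp : HasStrengthDecomp K d p k)
    (hq : HasStrengthDecomp K d q l) : HasStrengthDecomp K d (p + q) (k + l) := by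
  obtain ⟨e, r, s, h1, h2, hr, hs, rfl⟩ := hp
  obtain ⟨e', r', s', h1', h2', hr', hs', rfl⟩ := hq
  refine ⟨Fin.append e e', Fin.append r r', Fin.append s s', ?_, ?_, ?_, ?_, ?_⟩
  · exact fun i => Fin.addCases (by simpa using h1) (by simpa using h1') i
  · exact fun i => Fin.addCases (by simpa using h2) (by simpa using h2') i
  · exact fun i => Fin.addCases (by simpa using hr) (by simpa using hr') i
  · exact fun i => Fin.addCases (by simpa using hs) (by simpa using hs') i
  · simp [Fin.sum_univ_add]

theorem rename {p : MvPolynomial σ K} {k : ℕ} (hp : HasStrengthDecomp K d p k) (f : σ → τ) :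
    HasStrengthDecomp K d (MvPolynomial.rename f p) k := by
  obtain ⟨e, r, s, h1, h2, hr, hs, rfl⟩ := hp
  exact ⟨e, fun i => MvPolynomial.rename f (r i), fun i => MvPolynomial.rename f (s i), h1, h2,
    fun i => (hr i).rename_isHomogeneous, fun i => (hs i).rename_isHomogeneous, by simp⟩

theorem strength_le {p : MvPolynomial σ K} {k : ℕ} (hp : HasStrengthDecomp K d p k) :
    strength K d p ≤ k :=
  Nat.sInf_le hp

end HasStrengthDecomp

/-- In finitely many variables the infimum defining the strength is attained. -/
theorem hasStrengthDecomp_strength {K : Type} [Field K] {d : ℕ} (hd : 2 ≤ d) {n : ℕ}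
    {p : MvPolynomial (Fin n) K} (hp : p.IsHomogeneous d) :
    HasStrengthDecomp K d p (strength K d p) := by
  refine Nat.sInf_mem (s := {k | HasStrengthDecomp K d p k})
    ⟨n, hasStrengthDecomp_of_mem_span_X hd hp (f := id) ?_⟩
  rw [← Set.image_univ]
  refine mem_ideal_span_X_image.mpr fun m hm => ?_
  by_contra! h
  have h0 : m = 0 := Finsupp.ext fun i => h i (Set.mem_univ i)
  have hdeg := hp.degree_eq_sum_deg_support hm
  simp [h0] at hdeg
  omega

theorem isHomogeneous_lastComponent {K : Type} [Field K] {d u n : ℕ}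
    {q : MvPolynomial (Fin u ⊕ Fin n) K} (hq : q.IsHomogeneous d) :
    (lastComponent K q).IsHomogeneous d := by
  rw [← one_mul d]
  refine hq.aeval _ ?_
  rintro (i | i)
  · exact isHomogeneous_zero _ _ _
  · exact isHomogeneous_X K i

theorem sub_rename_lastComponent_mem_span {K : Type} [Field K] {u n : ℕ}
    (q : MvPolynomial (Fin u ⊕ Fin n) K) :
    q - rename Sum.inr (lastComponent K q) ∈
      Ideal.span (Set.range fun i : Fin u => (X (Sum.inl i) : MvPolynomial (Fin u ⊕ Fin n) K)) := by
  set I := Ideal.span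
    (Set.range fun i : Fin u => (X (Sum.inl i) : MvPolynomial (Fin u ⊕ Fin n) K))
  have h : Ideal.Quotient.mkₐ K I = (Ideal.Quotient.mkₐ K I).comp
      ((rename Sum.inr).comp (aeval (Sum.elim (fun _ => (0 : MvPolynomial (Fin n) K)) X))) := by
    refine algHom_ext ?_
    rintro (i | i)
    · have hi : (X (Sum.inl i) : MvPolynomial (Fin u ⊕ Fin n) K) ∈ I :=
        Ideal.subset_span ⟨i, rfl⟩
      simpa using Ideal.Quotient.eq_zero_iff_mem.mpr hi
    · simp
  exact Ideal.Quotient.eq.mp (DFunLike.congr_fun h q)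

/-- **Lemma (`lm:Chopping`).** Let `K` be a field, `d ≥ 2`, `U = K^u` and `V = K^n`.  For
`q ∈ S^d(U ⊕ V)` with component decomposition `q = q_0 + ⋯ + q_d`,
`q_i ∈ S^{d-i} U ⊗ S^i V`, one has `S(q) ≤ dim U + S(q_d)`. -/
theorem strength_le_dim_add_strength_lastComponent
    (K : Type) [Field K] (d : ℕ) (hd : 2 ≤ d) {u n : ℕ}
    (q : MvPolynomial (Fin u ⊕ Fin n) K) (hq : q.IsHomogeneous d) :
    strength K d q ≤ u + strength K d (lastComponent K q) := by
  have hlast := isHomogeneous_lastComponent hq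
  have h := (hasStrengthDecomp_of_mem_span_X hd (hq.sub hlast.rename_isHomogeneous)
    (sub_rename_lastComponent_mem_span q)).add
      ((hasStrengthDecomp_strength hd hlast).rename Sum.inr)
  rw [sub_add_cancel] at h
  exact h.strength_le

end
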